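/- Let A be a filtered ring with F₀A = B, and let S be a left Ore set in A such that S ∩ B is also a left Ore set in A, σ(S) is a left Ore set in G(A), G(A) is σ(S)-torsion free, and S ⊄ B. Then S ∩ B is a left Ore set in the Ore localization (S∖B)⁻¹A. -/

import Mathlib

/-- An exhaustive and separated ascending `ℤ`-filtration `F` on a ring `A`:
`1 ∈ F 0`, `F m * F n ⊆ F (m+n)`, `⋃ F n = A` and `⋂ F n = 0`. -/
structure RingFiltration (A : Type*) [Ring A] where
  F : ℤ → AddSubgroup A
  mono : Monotone F
  one_mem : (1 : A) ∈ F 0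
  mul_mem : ∀ {m n : ℤ} {x y : A}, x ∈ F m → y ∈ F n → x * y ∈ F (m + n)
  exhaustive : ∀ a : A, ∃ n : ℤ, a ∈ F n
  separated : ∀ a : A, (∀ n : ℤ, a ∈ F n) → a = 0
/-- Homogeneous formulation of: the associated graded ring `G(A)` is `σ(S)`-torsion
free.  For `a ∈ F n`, the hypothesis `∀ p, s ∈ F p → s * a ∈ F (p + n - 1)` says
exactly that `σ(s) · (a mod F (n-1)) = 0` in `G(A)`; torsion-freeness says that this
forces the class of `a` in `G(A)_n = F n / F (n-1)` to vanish. -/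
def RingFiltration.SigmaTorsionFree {A : Type*} [Ring A] (FA : RingFiltration A)
    (S : Set A) : Prop :=
  ∀ s ∈ S, ∀ n : ℤ, ∀ a ∈ FA.F n,
    (∀ p : ℤ, s ∈ FA.F p → s * a ∈ FA.F (p + n - 1)) → a ∈ FA.F (n - 1)
def MulClosed {A : Type*} [Mul A] (S : Set A) : Prop :=
  ∀ s ∈ S, ∀ t ∈ S, s * t ∈ S

/-- The left Ore condition for a subset `S` of a ring `A`. -/
def LeftOreCond {A : Type*} [Ring A] (S : Set A) : Prop :=
  ∀ a : A, ∀ s ∈ S, ∃ s' ∈ S, ∃ a' : A, s' * a = a' * s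

/-- The second (cancellation) left Ore condition. -/
def LeftOreCancel {A : Type*} [Ring A] (S : Set A) : Prop :=
  ∀ a : A, ∀ s ∈ S, a * s = 0 → ∃ s' ∈ S, s' * a = 0

/-- A left Ore set: a multiplicatively closed set containing `1` which satisfies
both left Ore conditions. -/
def IsLeftOreSet {A : Type*} [Ring A] (S : Set A) : Prop :=
  1 ∈ S ∧ MulClosed S ∧ LeftOreCond S ∧ LeftOreCancel S
/-- Homogeneous formulation of: `σ(S)` is a left Ore set in the associated graded
ring `G(A)`: the left Ore condition and the cancellation condition for the symbols
`σ(s)`, `s ∈ S`, on homogeneous elements of `G(A)`. -/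
def RingFiltration.SigmaLeftOre {A : Type*} [Ring A] (FA : RingFiltration A)
    (S : Set A) : Prop :=
  (∀ s ∈ S, ∀ p : ℤ, s ∈ FA.F p → ∀ (a : A) (n : ℤ), a ∈ FA.F n →
      ∃ s' ∈ S, ∃ p' : ℤ, s' ∈ FA.F p' ∧ ∃ a' : A, ∃ n' : ℤ, a' ∈ FA.F n' ∧
        p' + n = n' + p ∧ s' * a - a' * s ∈ FA.F (p' + n - 1)) ∧
  (∀ s ∈ S, ∀ p : ℤ, s ∈ FA.F p → ∀ (a : A) (n : ℤ), a ∈ FA.F n →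
      a * s ∈ FA.F (n + p - 1) →
      ∃ s' ∈ S, ∃ p' : ℤ, s' ∈ FA.F p' ∧ s' * a ∈ FA.F (p' + n - 1))
/-- `j : A →+* Q` realizes `Q` as the left Ore localization `S⁻¹A`:
elements of `S` become invertible, every element of `Q` is a left fraction
`(j s)⁻¹ * (j a)`, and the kernel of `j` is the `S`-torsion of `A`. -/
structure IsLeftOreLocalization {A Q : Type*} [Ring A] [Ring Q]
    (S : Set A) (j : A →+* Q) : Prop where
  unit : ∀ s ∈ S, IsUnit (j s)
  frac : ∀ q : Q, ∃ s ∈ S, ∃ a : A, j s * q = j a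
  ker : ∀ a : A, j a = 0 ↔ ∃ s ∈ S, s * a = 0

namespace RingFiltration

variable {A : Type*} [Ring A] (FA : RingFiltration A)

theorem exists_mem_notMem_of_notMem {a : A} {n : ℤ} (ha : a ∉ FA.F n) :
    ∃ m, n < m ∧ a ∈ FA.F m ∧ a ∉ FA.F (m - 1) := by
  have hbdd : ∀ m : ℤ, a ∈ FA.F m → n + 1 ≤ m := fun m hm => by
    by_contra! h
    exact ha (FA.mono (by lia) hm)
  obtain ⟨m, hm, hmin⟩ := Int.exists_least_of_bdd ⟨n + 1, hbdd⟩ (FA.exhaustive a)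
  refine ⟨m, hbdd m hm, hm, fun h => ?_⟩
  have := hmin _ h
  lia

variable {FA}

theorem SigmaTorsionFree.mul_notMem {S : Set A} (htf : FA.SigmaTorsionFree S) {s a : A}
    (hs : s ∈ S) {m n : ℤ} (hsm : s ∉ FA.F m) (han : a ∉ FA.F n) :
    s * a ∉ FA.F (m + n + 1) := by
  obtain ⟨d, hnd, had, had'⟩ := FA.exists_mem_notMem_of_notMem han
  refine fun h => had' (htf s hs d a had fun p hp => FA.mono ?_ h)
  have : m < p := by
    by_contra! hpm
    exact hsm (FA.mono hpm hp)
  lia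

theorem SigmaTorsionFree.pow_mul_notMem {S : Set A} (htf : FA.SigmaTorsionFree S) {t a : A}
    (ht : t ∈ S) (ht0 : t ∉ FA.F 0) {n : ℤ} (han : a ∉ FA.F n) (k : ℕ) :
    t ^ k * a ∉ FA.F (n + k) := by
  induction k with
  | zero => simpa using han
  | succ k ih =>
    have h := htf.mul_notMem ht ht0 ih
    rw [pow_succ', mul_assoc]
    convert h using 3
    push_cast
    ring

theorem SigmaTorsionFree.ne_zero {S : Set A} (htf : FA.SigmaTorsionFree S) {s a : A}
    (hs : s ∈ S) {n : ℤ} (han : a ∉ FA.F n) : s ≠ 0 := by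
  rintro rfl
  obtain ⟨d, -, had, had'⟩ := FA.exists_mem_notMem_of_notMem han
  exact had' (htf 0 hs d a had fun p _ => by simp)

theorem SigmaTorsionFree.exists_pow_mul_notMem {S : Set A} (htf : FA.SigmaTorsionFree S)
    {t a : A} (ht : t ∈ S) (ht0 : t ∉ FA.F 0) (ha : a ≠ 0) :
    ∃ k : ℕ, t ^ k * a ∉ FA.F 0 := by
  obtain ⟨n, hn⟩ : ∃ n, a ∉ FA.F n := by
    by_contra! h
    exact ha (FA.separated a h)
  exact ⟨n.natAbs, fun h => htf.pow_mul_notMem ht ht0 hn n.natAbs (FA.mono (by lia) h)⟩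

end RingFiltration

/-- Localizing at the elements of `S` of positive degree inverts all of `S`. -/
theorem IsLeftOreLocalization.isUnit_map {A Q : Type*} [Ring A] [Ring Q]
    {FA : RingFiltration A} {S : Set A} (hone : 1 ∈ S) (hmul : MulClosed S)
    (htf : FA.SigmaTorsionFree S) (hnotsub : ¬ S ⊆ (FA.F 0 : Set A)) {j : A →+* Q}
    (hloc : IsLeftOreLocalization (S \ (FA.F 0 : Set A)) j) {s : A} (hs : s ∈ S) :
    IsUnit (j s) := by
  obtain ⟨t, ht, ht0⟩ := Set.not_subset.mp hnotsub
  obtain ⟨k, hk⟩ := htf.exists_pow_mul_notMem ht ht0 (htf.ne_zero hs ht0)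
  have hpow : t ^ k ∈ S := by
    clear hk
    induction k with
    | zero => simpa using hone
    | succ k ih => exact pow_succ t k ▸ hmul _ ih _ ht
  have hu := hloc.unit _ ⟨hmul _ hpow _ hs, hk⟩
  rw [map_mul, map_pow] at hu
  obtain ⟨v, hv⟩ := (hloc.unit t ⟨ht, ht0⟩).pow k
  rw [← hv] at hu
  exact v.isUnit_units_mul _ |>.mp hu

/-- Under the standing hypotheses, `S ∩ B` is a left Ore set in the
Ore localization `(S ∖ B)⁻¹A` (realized by `j : A →+* Q`). -/
theorem stmt4 {A Q : Type*} [Ring A] [Ring Q] (FA : RingFiltration A) (S : Set A)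
    (hS : IsLeftOreSet S)
    (hSBore : IsLeftOreSet (S ∩ (FA.F 0 : Set A)))
    (hOre : FA.SigmaLeftOre S) (htf : FA.SigmaTorsionFree S)
    (hnotsub : ¬ S ⊆ (FA.F 0 : Set A))
    (j : A →+* Q) (hloc : IsLeftOreLocalization (S \ (FA.F 0 : Set A)) j) :
    (1 : Q) ∈ ⇑j '' (S ∩ (FA.F 0 : Set A)) ∧
    MulClosed (⇑j '' (S ∩ (FA.F 0 : Set A))) ∧
    LeftOreCond (⇑j '' (S ∩ (FA.F 0 : Set A))) ∧
    LeftOreCancel (⇑j '' (S ∩ (FA.F 0 : Set A))) := by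
  have h1 : (1 : Q) ∈ ⇑j '' (S ∩ (FA.F 0 : Set A)) := ⟨1, hSBore.1, map_one j⟩
  refine ⟨h1, ?_, ?_, ?_⟩
  · rintro _ ⟨s, hs, rfl⟩ _ ⟨t, ht, rfl⟩
    exact ⟨s * t, hSBore.2.1 s hs t ht, map_mul j s t⟩
  · rintro q _ ⟨s, hs, rfl⟩
    obtain ⟨u, hu⟩ := hloc.isUnit_map hS.1 hS.2.1 htf hnotsub hs.1
    exact ⟨1, h1, q * ↑u⁻¹, by simp [← hu]⟩
  · rintro q _ ⟨s, hs, rfl⟩ hq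
    have hu := hloc.isUnit_map hS.1 hS.2.1 htf hnotsub hs.1
    exact ⟨1, h1, by rw [one_mul, hu.mul_left_eq_zero.mp hq]⟩
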